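/- Let n ≥ 2, let Ω be a bounded domain (open connected set) in ℝⁿ, let 0 < δ ≤ n, and let p > δ/n. Then there exists a constant c depending only on n, δ, and p such that ∫_Ω |u(x)|^p dH^δ_∞ ≤ c · diam(Ω)^p ∫_Ω |∇u(x)|^p dH^δ_∞ for all u ∈ C¹_0(Ω) (continuously differentiable functions with compact support in Ω). -/

import Mathlib

open MeasureTheory Metric Set Bornology
open scoped ENNReal NNReal

/-- The `δ`-dimensional Hausdorff content of a set `E ⊆ ℝⁿ`, defined as the infimum of
`∑ᵢ rᵢ^δ` over all countable coverings of `E` by open balls `B(xᵢ, rᵢ)`. -/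
noncomputable def hContent (n : ℕ) (δ : ℝ) (E : Set (EuclideanSpace ℝ (Fin n))) : ℝ≥0∞ :=
  ⨅ (x : ℕ → EuclideanSpace ℝ (Fin n)) (r : ℕ → ℝ≥0)
    (_ : E ⊆ ⋃ i, Metric.ball (x i) (r i)), ∑' i, (r i : ℝ≥0∞) ^ δ

/-- The `δ`-dimensional Hausdorff measure of `E ⊆ ℝⁿ`, obtained from coverings by open balls of
radii at most `ρ`, in the limit `ρ → 0⁺` (equivalently: the supremum over `ρ > 0`, since the
infima increase as `ρ` decreases). -/
noncomputable def hMeasure (n : ℕ) (δ : ℝ) (E : Set (EuclideanSpace ℝ (Fin n))) : ℝ≥0∞ :=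
  ⨆ (ρ : ℝ≥0) (_ : 0 < ρ),
    ⨅ (x : ℕ → EuclideanSpace ℝ (Fin n)) (r : ℕ → ℝ≥0)
      (_ : E ⊆ ⋃ i, Metric.ball (x i) (r i)) (_ : ∀ i, r i ≤ ρ), ∑' i, (r i : ℝ≥0∞) ^ δ

/-- The Choquet integral `∫_Ω f dH^δ_∞ = ∫₀^∞ H^δ_∞({x ∈ Ω : f x > t}) dt` of a
(nonnegative) real-valued function with respect to the Hausdorff content. -/
noncomputable def choquet (n : ℕ) (δ : ℝ) (Ω : Set (EuclideanSpace ℝ (Fin n)))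
    (f : EuclideanSpace ℝ (Fin n) → ℝ) : ℝ≥0∞ :=
  ∫⁻ t in Set.Ioi (0 : ℝ), hContent n δ {x ∈ Ω | t < f x}

/-- The Choquet integral of an `[0,∞]`-valued function with respect to the Hausdorff content. -/
noncomputable def echoquet (n : ℕ) (δ : ℝ) (Ω : Set (EuclideanSpace ℝ (Fin n)))
    (f : EuclideanSpace ℝ (Fin n) → ℝ≥0∞) : ℝ≥0∞ :=
  ∫⁻ t in Set.Ioi (0 : ℝ), hContent n δ {x ∈ Ω | ENNReal.ofReal t < f x}

/-- The centered fractional Hardy–Littlewood maximal function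
`M_κ f (x) = sup_{r>0} r^{κ-n} ∫_{B(x,r)} |f|`. -/
noncomputable def fracMaximal (n : ℕ) (κ : ℝ) (f : EuclideanSpace ℝ (Fin n) → ℝ)
    (x : EuclideanSpace ℝ (Fin n)) : ℝ≥0∞ :=
  ⨆ (r : ℝ) (_ : 0 < r),
    ENNReal.ofReal (r ^ (κ - n)) * ∫⁻ y in Metric.ball x r, ENNReal.ofReal |f y|

/-- The Riesz potential of order `1`: `I₁ f (x) = ∫_{ℝⁿ} |f y| / |x-y|^{n-1} dy`. -/
noncomputable def rieszPot (n : ℕ) (f : EuclideanSpace ℝ (Fin n) → ℝ)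
    (x : EuclideanSpace ℝ (Fin n)) : ℝ≥0∞ :=
  ∫⁻ y, ENNReal.ofReal |f y| / edist x y ^ ((n : ℝ) - 1)

/-- `Ω` is an `(α, β)`-John domain with John center `x₀`: every `x ∈ Ω` can be joined to `x₀`
by a rectifiable curve `γ : [0, L] → Ω` parametrized by arclength (hence `1`-Lipschitz) with
`γ 0 = x`, `γ L = x₀`, `L ≤ β` and `dist (γ t, ∂Ω) ≥ (α/β) t`. -/
def IsJohnDomainWithCenter (n : ℕ) (α β : ℝ) (Ω : Set (EuclideanSpace ℝ (Fin n)))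
    (x₀ : EuclideanSpace ℝ (Fin n)) : Prop :=
  x₀ ∈ Ω ∧ ∀ x ∈ Ω, ∃ L : ℝ, 0 ≤ L ∧ L ≤ β ∧ ∃ γ : ℝ → EuclideanSpace ℝ (Fin n),
    γ 0 = x ∧ γ L = x₀ ∧ (∀ t ∈ Set.Icc 0 L, γ t ∈ Ω) ∧
    LipschitzOnWith 1 γ (Set.Icc 0 L) ∧
    ∀ t ∈ Set.Icc 0 L, α / β * t ≤ Metric.infDist (γ t) (frontier Ω)

/-- `Ω` is an `(α, β)`-John domain. -/
def IsJohnDomain (n : ℕ) (α β : ℝ) (Ω : Set (EuclideanSpace ℝ (Fin n))) : Prop :=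
  ∃ x₀, IsJohnDomainWithCenter n α β Ω x₀

theorem ENNReal.rpow_tsum_le_tsum_rpow {ι : Type*} (a : ι → ℝ≥0∞) {q : ℝ} (hq0 : 0 < q)
    (hq1 : q ≤ 1) : (∑' i, a i) ^ q ≤ ∑' i, a i ^ q := by
  refine le_of_tendsto' ((ENNReal.continuous_rpow_const.tendsto _).comp
    ENNReal.summable.hasSum) fun s => ?_
  refine le_trans ?_ (ENNReal.sum_le_tsum s)
  classical
  simp only [Function.comp_apply]
  induction s using Finset.induction_on with
  | empty => simp [hq0]
  | insert i s hi ih =>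
    rw [Finset.sum_insert hi, Finset.sum_insert hi]
    exact (ENNReal.rpow_add_le_add_rpow _ _ hq0.le hq1).trans (by gcongr)

section HausdorffContent

variable {n : ℕ} {δ : ℝ}

theorem hContent_mono {S T : Set (EuclideanSpace ℝ (Fin n))} (h : S ⊆ T) :
    hContent n δ S ≤ hContent n δ T :=
  le_iInf fun x => le_iInf fun r => le_iInf fun hT =>
    iInf_le_of_le x <| iInf_le_of_le r <| iInf_le_of_le (h.trans hT) le_rfl

theorem hContent_le_tsum (hδ : 0 < δ) {ι : Type*} [Countable ι]
    {S : Set (EuclideanSpace ℝ (Fin n))} (c : ι → EuclideanSpace ℝ (Fin n)) (r : ι → ℝ≥0)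
    (h : S ⊆ ⋃ i, ball (c i) (r i)) : hContent n δ S ≤ ∑' i, (r i : ℝ≥0∞) ^ δ := by
  obtain ⟨f, hf⟩ := Countable.exists_injective_nat ι
  have hsum : ∑' k, ((Function.extend f r 0 k : ℝ≥0) : ℝ≥0∞) ^ δ = ∑' i, (r i : ℝ≥0∞) ^ δ := by
    rw [← hf.tsum_eq]
    · simp [hf.extend_apply]
    · intro k hk
      by_contra hk'
      refine hk ?_
      simp [Function.extend_apply' _ _ _ hk', hδ]
  rw [← hsum]
  refine iInf_le_of_le (Function.extend f c 0) <| iInf_le_of_le (Function.extend f r 0) <|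
    iInf_le_of_le (h.trans (iUnion_subset fun i => ?_)) le_rfl
  refine subset_iUnion_of_subset (f i) ?_
  rw [hf.extend_apply, hf.extend_apply]

theorem hContent_union_le (hδ : 0 < δ) (S T : Set (EuclideanSpace ℝ (Fin n))) :
    hContent n δ (S ∪ T) ≤ hContent n δ S + hContent n δ T := by
  conv_rhs => rw [hContent, hContent]
  simp only [ENNReal.iInf_add, ENNReal.add_iInf]
  refine le_iInf fun x => le_iInf fun r => le_iInf fun hS =>
    le_iInf fun y => le_iInf fun s => le_iInf fun hT => ?_
  refine (hContent_le_tsum hδ (Sum.elim y x) (Sum.elim s r) ?_).trans_eq ?_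
  · rw [iUnion_sum]
    exact union_subset_union hT hS
  · rw [ENNReal.summable.tsum_sum ENNReal.summable]
    rfl

theorem exists_cover_tsum_le (S : Set (EuclideanSpace ℝ (Fin n))) {ε : ℝ≥0∞} (hε : ε ≠ 0) :
    ∃ (c : ℕ → EuclideanSpace ℝ (Fin n)) (r : ℕ → ℝ≥0), S ⊆ ⋃ i, ball (c i) (r i) ∧
      ∑' i, (r i : ℝ≥0∞) ^ δ ≤ hContent n δ S + ε := by
  by_cases hS : hContent n δ S = ⊤
  · refine ⟨0, fun i => i, fun x _ => mem_iUnion.2 ?_, by simp [hS]⟩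
    obtain ⟨k, hk⟩ := exists_nat_gt (dist x 0)
    exact ⟨k, by simpa using hk⟩
  · have h := ENNReal.lt_add_right hS hε
    conv_lhs at h => rw [hContent]
    simp only [iInf_lt_iff] at h
    obtain ⟨c, r, hc, h⟩ := h
    exact ⟨c, r, hc, h.le⟩

/-- A Vitali covering argument: content is controlled by any measure with large `δ`-density. -/
theorem hContent_le_measure_univ (hδ : 0 < δ) (μ : Measure (EuclideanSpace ℝ (Fin n)))
    (S : Set (EuclideanSpace ℝ (Fin n)))
    (hS : ∀ x ∈ S, ∃ R : ℝ≥0, 0 < R ∧ (R : ℝ≥0∞) ^ δ ≤ μ (closedBall x R)) :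
    hContent n δ S ≤ 6 ^ δ * μ univ := by
  by_cases hμ : μ univ = ⊤
  · simp [hμ, ENNReal.mul_top, hδ.not_gt]
  choose! R hR0 hR using hS
  have hbd : ∀ x ∈ S, (R x : ℝ) ≤ ((μ univ) ^ δ⁻¹).toReal := fun x hx => by
    have h1 : (R x : ℝ≥0∞) ≤ (μ univ) ^ δ⁻¹ := by
      rw [ENNReal.le_rpow_inv_iff hδ]
      exact (hR x hx).trans (measure_mono (subset_univ _))
    have := ENNReal.toReal_mono (ENNReal.rpow_ne_top_of_nonneg (by positivity) hμ) h1
    simpa using this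
  obtain ⟨U, hUS, hUd, hU⟩ := Vitali.exists_disjoint_subfamily_covering_enlargement_closedBall S
    id (fun x => (R x : ℝ)) _ hbd 5 (by norm_num)
  have hUc : U.Countable := hUd.countable_of_nonempty_interior fun x hx =>
    ⟨x, ball_subset_interior_closedBall (mem_ball_self (hR0 x (hUS hx)))⟩
  have := hUc.to_subtype
  calc hContent n δ S ≤ ∑' x : U, ((6 * R x : ℝ≥0) : ℝ≥0∞) ^ δ := by
        refine hContent_le_tsum hδ (fun x : U => (x : EuclideanSpace ℝ (Fin n))) _ fun x hx => ?_
        obtain ⟨y, hy, hxy⟩ := hU x hx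
        refine mem_iUnion.2 ⟨⟨y, hy⟩, ?_⟩
        have h1 := hxy (mem_closedBall_self (R x).2)
        have h2 : (0 : ℝ) < R y := hR0 y (hUS hy)
        simp only [id, mem_closedBall, mem_ball] at h1 ⊢
        push_cast
        linarith
    _ ≤ ∑' x : U, 6 ^ δ * μ (closedBall x (R x)) := by
        refine ENNReal.tsum_le_tsum fun x => ?_
        rw [ENNReal.coe_mul, ENNReal.mul_rpow_of_nonneg _ _ hδ.le]
        gcongr
        · norm_num
        · exact hR _ (hUS x.2)
    _ = 6 ^ δ * μ (⋃ x ∈ U, closedBall x (R x)) := by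
        rw [ENNReal.tsum_mul_left, measure_biUnion (f := fun x => closedBall x (R x)) hUc hUd
          fun x _ => measurableSet_closedBall]
    _ ≤ 6 ^ δ * μ univ := by gcongr; exact subset_univ _

end HausdorffContent

section MaximalEstimate

variable {n : ℕ}

theorem volume_mul_enorm_le_lintegral_fderiv {u : EuclideanSpace ℝ (Fin n) → ℝ}
    (hu : ContDiff ℝ 1 u) {x v₀ : EuclideanSpace ℝ (Fin n)} (hv₀ : ‖v₀‖ = 2) {D : ℝ} (hD : 0 ≤ D)
    (h0 : ∀ v ∈ ball v₀ 1, u (x + D • v) = 0) :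
    volume (ball v₀ 1) * ‖u x‖ₑ
      ≤ 3 * ∫⁻ s in Icc 0 D, ∫⁻ v in ball v₀ 1, ‖fderiv ℝ u (x + s • v)‖ₑ := by
  have hcont : Continuous (fderiv ℝ u) := hu.continuous_fderiv one_ne_zero
  have key : ∀ v ∈ ball v₀ 1,
      ‖u x‖ₑ ≤ 3 * ∫⁻ s in Icc 0 D, ‖fderiv ℝ u (x + s • v)‖ₑ := by
    intro v hv
    have hvn : ‖v‖ₑ ≤ 3 := by
      have h1 : ‖v‖ ≤ 3 := by
        have h2 : ‖v - v₀‖ < 1 := by simpa [dist_eq_norm] using hv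
        have h3 := norm_le_norm_add_norm_sub' v v₀
        linarith
      rw [← ofReal_norm]
      exact (ENNReal.ofReal_le_ofReal h1).trans_eq (by norm_num)
    have hf : ContDiff ℝ 1 fun s : ℝ => u (x + s • v) := by fun_prop
    have h1 := enorm_sub_le_lintegral_deriv_of_contDiffOn_Icc hf.contDiffOn hD
    rw [h0 v hv] at h1
    simp only [zero_smul, add_zero, zero_sub, enorm_neg] at h1
    refine h1.trans ?_
    rw [← lintegral_const_mul' _ _ (by norm_num)]
    refine lintegral_mono fun s => ?_
    have hd : HasDerivAt (fun s : ℝ => u (x + s • v)) (fderiv ℝ u (x + s • v) v) s := by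
      have hl : HasDerivAt (fun s : ℝ => x + s • v) v s := by
        simpa using ((hasDerivAt_id s).smul_const v).const_add x
      exact ((hu.differentiable one_ne_zero _).hasFDerivAt).comp_hasDerivAt s hl
    rw [hd.deriv]
    calc ‖fderiv ℝ u (x + s • v) v‖ₑ ≤ ‖fderiv ℝ u (x + s • v)‖ₑ * ‖v‖ₑ :=
          ContinuousLinearMap.le_opENorm _ _
      _ ≤ _ := by rw [mul_comm]; gcongr
  calc volume (ball v₀ 1) * ‖u x‖ₑ = ∫⁻ _ in ball v₀ 1, ‖u x‖ₑ := by
        rw [setLIntegral_const, mul_comm]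
    _ ≤ ∫⁻ v in ball v₀ 1, 3 * ∫⁻ s in Icc 0 D, ‖fderiv ℝ u (x + s • v)‖ₑ :=
        setLIntegral_mono' measurableSet_ball key
    _ = _ := by
        rw [lintegral_const_mul' _ _ (by norm_num), lintegral_lintegral_swap]
        refine Measurable.aemeasurable (Continuous.measurable ?_)
        exact (hcont.comp (by fun_prop)).enorm

theorem setLIntegral_comp_add_smul_le {ι : Type*} [Countable ι]
    {G : EuclideanSpace ℝ (Fin n) → ℝ≥0∞} {T : ℝ≥0∞} {a : ι → ℝ≥0∞}
    {c : ι → EuclideanSpace ℝ (Fin n)} {r : ι → ℝ≥0}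
    (hG : ∀ y, G y ≤ T + ∑' i, (ball (c i) (r i)).indicator (fun _ => a i) y)
    {x v₀ : EuclideanSpace ℝ (Fin n)} (hv₀ : ‖v₀‖ = 2) (hx : ∀ i, x ∉ ball (c i) (2 * r i))
    {s : ℝ≥0} (hs : 0 < s) :
    ∫⁻ v in ball v₀ 1, G (x + (s : ℝ) • v)
      ≤ volume (ball v₀ 1) *
        (T + ∑' i, (ball x (6 * s)).indicator (fun _ => a i * ((r i : ℝ≥0∞) / s) ^ n) (c i)) := by
  have hs' : (0 : ℝ) < s := hs
  have hmeas : ∀ i, MeasurableSet {v : EuclideanSpace ℝ (Fin n) | x + (s : ℝ) • v ∈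
      ball (c i) (r i)} := fun i =>
    (isOpen_ball.preimage (f := fun v => x + (s : ℝ) • v) (by fun_prop)).measurableSet
  have hind : ∀ i, (fun v => (ball (c i) (r i)).indicator (fun _ => a i) (x + (s : ℝ) • v)) =
      {v | x + (s : ℝ) • v ∈ ball (c i) (r i)}.indicator fun _ => a i := fun i => rfl
  have hterm : ∀ i, ∫⁻ v in ball v₀ 1,
      (ball (c i) (r i)).indicator (fun _ => a i) (x + (s : ℝ) • v)
      ≤ volume (ball v₀ 1) *
        (ball x (6 * s)).indicator (fun _ => a i * ((r i : ℝ≥0∞) / s) ^ n) (c i) := by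
    intro i
    rw [hind, lintegral_indicator_const (hmeas i)]
    by_cases hci : c i ∈ ball x (6 * s)
    · rw [indicator_of_mem hci, mul_left_comm]
      gcongr
      have hsub : {v | x + (s : ℝ) • v ∈ ball (c i) (r i)} ⊆
          ball ((s : ℝ)⁻¹ • (c i - x)) ((r i / s : ℝ≥0) : ℝ) := by
        intro v hv
        simp only [mem_ofPred_eq, mem_ball, dist_eq_norm] at hv ⊢
        have : v - (s : ℝ)⁻¹ • (c i - x) = (s : ℝ)⁻¹ • (x + (s : ℝ) • v - c i) := by
          rw [← sub_eq_zero]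
          simp only [smul_sub, smul_add, inv_smul_smul₀ hs'.ne']
          abel
        rw [this, norm_smul, norm_inv, Real.norm_eq_abs, abs_of_pos hs', NNReal.coe_div,
          div_eq_inv_mul]
        gcongr
      refine (Measure.restrict_apply_le _ _).trans ((measure_mono hsub).trans_eq ?_)
      have : Nontrivial (EuclideanSpace ℝ (Fin n)) :=
        nontrivial_of_ne v₀ 0 (norm_ne_zero_iff.1 (by rw [hv₀]; norm_num))
      rw [Measure.addHaar_ball _ _ (NNReal.coe_nonneg _), Measure.addHaar_ball_center volume v₀,
        mul_comm, finrank_euclideanSpace_fin, ENNReal.ofReal_pow (NNReal.coe_nonneg _),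
        ENNReal.ofReal_coe_nnreal, ENNReal.coe_div hs.ne']
    · have : {v | x + (s : ℝ) • v ∈ ball (c i) (r i)} ∩ ball v₀ 1 = ∅ := by
        by_contra hne
        obtain ⟨v, hv, hv1⟩ := nonempty_iff_ne_empty.2 hne
        have hxi := hx i
        simp only [mem_ofPred_eq, mem_ball, not_lt, dist_eq_norm] at hv hv1 hxi hci
        have h1 := norm_le_norm_add_norm_sub' v v₀
        have h2 : ‖(s : ℝ) • v‖ ≤ s * 3 := by
          rw [norm_smul, Real.norm_eq_abs, abs_of_pos hs']
          gcongr
          linarith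
        have h3 : ‖x - c i‖ ≤ ‖x + (s : ℝ) • v - c i‖ + ‖(s : ℝ) • v‖ := by
          refine le_trans (le_of_eq ?_) (norm_sub_le _ _)
          congr 1
          abel
        rw [norm_sub_rev] at hci
        linarith
      rw [Measure.restrict_apply (hmeas i), this]
      simp
  calc _ ≤ ∫⁻ v in ball v₀ 1,
        (T + ∑' i, (ball (c i) (r i)).indicator (fun _ => a i) (x + (s : ℝ) • v)) :=
        lintegral_mono fun v => hG _
    _ = volume (ball v₀ 1) * T + ∑' i, ∫⁻ v in ball v₀ 1,
        (ball (c i) (r i)).indicator (fun _ => a i) (x + (s : ℝ) • v) := by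
        rw [lintegral_add_left measurable_const, setLIntegral_const, lintegral_tsum, mul_comm]
        intro i
        rw [hind]
        exact (measurable_const.indicator (hmeas i)).aemeasurable
    _ ≤ _ := by
        rw [mul_add, ← ENNReal.tsum_mul_left]
        gcongr with i
        exact hterm i

end MaximalEstimate

section WeakEstimate

variable {n : ℕ} {δ : ℝ}

theorem le_add_tsum_indicator_of_cover {α : Type*} {G : α → ℝ≥0∞} (hG : ∀ y, G y ≠ ⊤) {T : ℝ≥0∞}
    (hT0 : T ≠ 0) {B : ℕ × ℕ → Set α}
    (hB : ∀ k : ℕ, {y | T * 2 ^ k < G y} ⊆ ⋃ j, B (k, j)) (y : α) :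
    G y ≤ T + ∑' i, (B i).indicator (fun _ => T * 2 ^ (i.1 + 1)) y := by
  by_cases hy : G y ≤ T
  · exact hy.trans le_self_add
  have hex : ∃ k : ℕ, G y ≤ T * 2 ^ k := by
    obtain ⟨k, hk⟩ := ENNReal.exists_nat_mul_gt hT0 (hG y)
    refine ⟨k, hk.le.trans ?_⟩
    rw [mul_comm]
    gcongr
    exact_mod_cast k.lt_two_pow_self.le
  classical
  obtain ⟨k, hk⟩ : ∃ k, Nat.find hex = k + 1 :=
    Nat.exists_eq_succ_of_ne_zero fun h => hy (by simpa [h] using Nat.find_spec hex)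
  obtain ⟨j, hj⟩ := mem_iUnion.1 (hB k (not_le.1 (Nat.find_min hex (m := k) (by lia))))
  calc G y ≤ T * 2 ^ (k + 1) := hk ▸ Nat.find_spec hex
    _ = (B (k, j)).indicator (fun _ => T * 2 ^ (k + 1)) y := by rw [indicator_of_mem hj]
    _ ≤ ∑' i, (B i).indicator (fun _ => T * 2 ^ (i.1 + 1)) y :=
        ENNReal.le_tsum (f := fun i : ℕ × ℕ => (B i).indicator (fun _ => T * 2 ^ (i.1 + 1)) y) (k, j)
    _ ≤ _ := le_add_self

theorem hContent_superlevel_le_of_cover (hn : 2 ≤ n) (hδ : 0 < δ) (hδn : δ ≤ n)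
    {Ω : Set (EuclideanSpace ℝ (Fin n))} {D : ℝ≥0} {v₀ : EuclideanSpace ℝ (Fin n)}
    (hv₀ : ‖v₀‖ = 2) (hΩ : ∀ x ∈ Ω, ∀ v ∈ ball v₀ 1, x + (D : ℝ) • v ∉ Ω)
    {u : EuclideanSpace ℝ (Fin n) → ℝ} (hu : ContDiff ℝ 1 u) (hu0 : ∀ x ∉ Ω, u x = 0)
    {T : ℝ≥0} (hT : 0 < T) (c : ℕ × ℕ → EuclideanSpace ℝ (Fin n)) (r : ℕ × ℕ → ℝ≥0)
    (hc : ∀ k : ℕ, {y | (T : ℝ≥0∞) * 2 ^ k < ‖fderiv ℝ u y‖ₑ} ⊆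
      ⋃ j, ball (c (k, j)) (r (k, j))) :
    hContent n δ {x ∈ Ω | (6 * D * T : ℝ≥0∞) < ‖u x‖ₑ} ≤
      (2 ^ δ + 36 ^ δ) * ∑' i, ((2 : ℝ≥0∞) ^ (i.1 + 1)) ^ (δ / n) * (r i : ℝ≥0∞) ^ δ := by
  have hn0 : (0 : ℝ) < n := by positivity
  set q := δ / n with hq
  have hq0 : 0 < q := by positivity
  have hq1 : q ≤ 1 := (div_le_one hn0).2 hδn
  set w : ℕ × ℕ → ℝ≥0∞ := fun i => ((2 : ℝ≥0∞) ^ (i.1 + 1)) ^ q * (r i : ℝ≥0∞) ^ δ with hw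
  have hG := le_add_tsum_indicator_of_cover (G := fun y => ‖fderiv ℝ u y‖ₑ)
    (fun y => enorm_ne_top) (T := T) (by simpa using hT.ne')
    (B := fun i => ball (c i) (r i)) hc
  set μ : Measure (EuclideanSpace ℝ (Fin n)) :=
    (6 : ℝ≥0∞) ^ δ • Measure.sum fun i => w i • Measure.dirac (c i) with hμ
  have hμu : μ univ = 6 ^ δ * ∑' i, w i := by simp [hμ]
  set F : Set (EuclideanSpace ℝ (Fin n)) :=
    {x ∈ Ω | (6 * D * T : ℝ≥0∞) < ‖u x‖ₑ} \ ⋃ i, ball (c i) (2 * r i) with hF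
  have hvol0 : volume (ball v₀ 1) ≠ 0 := (measure_ball_pos _ _ one_pos).ne'
  have hvolt : volume (ball v₀ 1) ≠ ⊤ := measure_ball_lt_top.ne
  have hFR : ∀ x ∈ F, ∃ R : ℝ≥0, 0 < R ∧ (R : ℝ≥0∞) ^ δ ≤ μ (closedBall x R) := by
    rintro x ⟨⟨hxΩ, hx⟩, hxc⟩
    simp only [mem_iUnion, not_exists] at hxc
    obtain ⟨s, hs0, hs⟩ : ∃ s : ℝ≥0, 0 < s ∧
        volume (ball v₀ 1) * (2 * T) < ∫⁻ v in ball v₀ 1, ‖fderiv ℝ u (x + (s : ℝ) • v)‖ₑ := by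
      by_contra! hcon
      refine hx.not_ge ?_
      have h1 := volume_mul_enorm_le_lintegral_fderiv hu (x := x) hv₀ D.2
        fun v hv => hu0 _ (hΩ x hxΩ v hv)
      have h2 : ∫⁻ s in Icc 0 (D : ℝ), ∫⁻ v in ball v₀ 1, ‖fderiv ℝ u (x + s • v)‖ₑ ≤
          volume (ball v₀ 1) * (2 * T) * D := by
        rw [restrict_Ioc_eq_restrict_Icc.symm]
        refine (setLIntegral_mono' measurableSet_Ioc
          fun s hs => hcon ⟨s, hs.1.le⟩ hs.1).trans_eq ?_
        rw [setLIntegral_const, Real.volume_Ioc, sub_zero, ENNReal.ofReal_coe_nnreal]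
      rw [← ENNReal.mul_le_mul_iff_right hvol0 hvolt]
      refine h1.trans ((mul_le_mul_right h2 3).trans_eq ?_)
      ring
    have h1 := hs.trans_le (setLIntegral_comp_add_smul_le hG hv₀ hxc hs0)
    rw [ENNReal.mul_lt_mul_iff_right hvol0 hvolt, two_mul,
      ENNReal.add_lt_add_iff_left ENNReal.coe_ne_top] at h1
    have h2 : ∀ i, (ball x (6 * s)).indicator
        (fun _ => (T : ℝ≥0∞) * 2 ^ (i.1 + 1) * ((r i : ℝ≥0∞) / s) ^ n) (c i) ^ q =
        (T : ℝ≥0∞) ^ q * ((s : ℝ≥0∞) ^ δ)⁻¹ * (w i * (ball x (6 * s)).indicator 1 (c i)) := by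
      intro i
      by_cases hi : c i ∈ ball x (6 * s)
      · simp only [indicator_of_mem hi, Pi.one_apply, mul_one, hw]
        rw [ENNReal.mul_rpow_of_nonneg _ _ hq0.le, ENNReal.mul_rpow_of_nonneg _ _ hq0.le,
          ← ENNReal.rpow_natCast _ n, ← ENNReal.rpow_mul, hq,
          mul_div_cancel₀ _ hn0.ne',
          ENNReal.div_rpow_of_nonneg _ _ hδ.le, div_eq_mul_inv (_ ^ δ)]
        ring
      · simp [indicator_of_notMem hi, hq0]
    have h3 := (ENNReal.rpow_le_rpow h1.le hq0.le).trans
      (ENNReal.rpow_tsum_le_tsum_rpow _ hq0 hq1)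
    simp only [h2] at h3
    rw [ENNReal.tsum_mul_left] at h3
    refine ⟨6 * s, by positivity, ?_⟩
    have h4 : (s : ℝ≥0∞) ^ δ ≤ ∑' i, w i * (ball x (6 * s)).indicator 1 (c i) := by
      have hTq0 : (T : ℝ≥0∞) ^ q ≠ 0 := by simp [hT.ne']
      have hTqt : (T : ℝ≥0∞) ^ q ≠ ⊤ := ENNReal.rpow_ne_top_of_nonneg hq0.le ENNReal.coe_ne_top
      have hsδ0 : (s : ℝ≥0∞) ^ δ ≠ 0 := by simp [hs0.ne']
      have hsδt : (s : ℝ≥0∞) ^ δ ≠ ⊤ := ENNReal.rpow_ne_top_of_nonneg hδ.le ENNReal.coe_ne_top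
      nth_rewrite 1 [← mul_one ((T : ℝ≥0∞) ^ q)] at h3
      rw [mul_assoc, ENNReal.mul_le_mul_iff_right hTq0 hTqt, mul_comm, ← div_eq_mul_inv,
        ENNReal.le_div_iff_mul_le (Or.inl hsδ0) (Or.inl hsδt), one_mul] at h3
      exact h3
    calc ((6 * s : ℝ≥0) : ℝ≥0∞) ^ δ = 6 ^ δ * (s : ℝ≥0∞) ^ δ := by
          rw [ENNReal.coe_mul, ENNReal.mul_rpow_of_nonneg _ _ hδ.le]; norm_num
      _ ≤ 6 ^ δ * ∑' i, w i * (ball x (6 * s)).indicator 1 (c i) := by gcongr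
      _ = μ (ball x (6 * s)) := by
          simp [hμ, Measure.sum_apply _ measurableSet_ball]
      _ ≤ _ := measure_mono (by push_cast; exact ball_subset_closedBall)
  calc _ ≤ hContent n δ ((⋃ i, ball (c i) (2 * r i)) ∪ F) := by
        refine hContent_mono ?_
        rw [hF, union_sdiff_self]
        exact subset_union_right
    _ ≤ ∑' i, ((2 * r i : ℝ≥0) : ℝ≥0∞) ^ δ + 6 ^ δ * μ univ :=
        (hContent_union_le hδ _ _).trans (add_le_add
          (hContent_le_tsum hδ c (fun i => 2 * r i) (by simp))
          (hContent_le_measure_univ hδ μ F hFR))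
    _ ≤ _ := by
        rw [hμu, ← mul_assoc, ← ENNReal.mul_rpow_of_nonneg _ _ hδ.le, add_mul]
        norm_num
        gcongr
        rw [← ENNReal.tsum_mul_left]
        refine ENNReal.tsum_le_tsum fun i => ?_
        rw [ENNReal.mul_rpow_of_nonneg _ _ hδ.le]
        gcongr
        exact le_mul_of_one_le_left' (ENNReal.one_le_rpow (one_le_pow₀ one_le_two) hq0)

/-- Weak-type estimate at the endpoint exponent `δ / n`, in dyadic form. -/
theorem hContent_superlevel_le_tsum (hn : 2 ≤ n) (hδ : 0 < δ) (hδn : δ ≤ n)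
    {Ω : Set (EuclideanSpace ℝ (Fin n))} {D : ℝ≥0} {v₀ : EuclideanSpace ℝ (Fin n)}
    (hv₀ : ‖v₀‖ = 2) (hΩ : ∀ x ∈ Ω, ∀ v ∈ ball v₀ 1, x + (D : ℝ) • v ∉ Ω)
    {u : EuclideanSpace ℝ (Fin n) → ℝ} (hu : ContDiff ℝ 1 u) (hu0 : ∀ x ∉ Ω, u x = 0)
    {T : ℝ≥0} (hT : 0 < T) :
    hContent n δ {x ∈ Ω | (6 * D * T : ℝ≥0∞) < ‖u x‖ₑ} ≤
      (2 ^ δ + 36 ^ δ) * ∑' k : ℕ, ((2 : ℝ≥0∞) ^ (k + 1)) ^ (δ / n) *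
        hContent n δ {y | (T : ℝ≥0∞) * 2 ^ k < ‖fderiv ℝ u y‖ₑ} := by
  set K : ℝ≥0∞ := 2 ^ δ + 36 ^ δ with hKdef
  have hKt : K ≠ ⊤ := by finiteness
  have hK0 : K ≠ 0 := by simp [hKdef]
  set W : ℕ → ℝ≥0∞ := fun k => ((2 : ℝ≥0∞) ^ (k + 1)) ^ (δ / n) with hW
  have hWt : ∀ k, W k ≠ ⊤ := fun k =>
    ENNReal.rpow_ne_top_of_nonneg (by positivity) (by finiteness)
  refine ENNReal.le_of_forall_pos_le_add fun ε hε _ => ?_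
  obtain ⟨η, hη0, hη⟩ := ENNReal.exists_pos_tsum_mul_lt_of_countable
    (ENNReal.div_ne_zero.2 ⟨ENNReal.coe_ne_zero.2 hε.ne', hKt⟩) W hWt
  choose c r hc hr using fun k => exists_cover_tsum_le (δ := δ)
    {y | (T : ℝ≥0∞) * 2 ^ k < ‖fderiv ℝ u y‖ₑ} (ENNReal.coe_ne_zero.2 (hη0 k).ne')
  calc _ ≤ K * ∑' i : ℕ × ℕ, W i.1 * (r i.1 i.2 : ℝ≥0∞) ^ δ :=
        hContent_superlevel_le_of_cover hn hδ hδn hv₀ hΩ hu hu0 hT (fun i => c i.1 i.2)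
          (fun i => r i.1 i.2) hc
    _ = K * ∑' k, W k * ∑' j, (r k j : ℝ≥0∞) ^ δ := by
        rw [ENNReal.tsum_prod']
        simp only [ENNReal.tsum_mul_left]
    _ ≤ K * ∑' k, W k * (hContent n δ {y | (T : ℝ≥0∞) * 2 ^ k < ‖fderiv ℝ u y‖ₑ} + η k) := by
        gcongr with k
        exact hr k
    _ ≤ K * (∑' k, W k * hContent n δ {y | (T : ℝ≥0∞) * 2 ^ k < ‖fderiv ℝ u y‖ₑ} + ε / K) := by
        simp only [mul_add, ENNReal.tsum_add]
        gcongr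
    _ = _ := by rw [mul_add, ENNReal.mul_div_cancel hK0 hKt]

end WeakEstimate

section DyadicSums

theorem Antitone.lintegral_Ioi_le_tsum_zpow {φ : ℝ → ℝ≥0∞} (hφ : Antitone φ) {a b : ℝ}
    (ha : 0 < a) (hb : 1 < b) :
    ∫⁻ t in Ioi 0, φ t ≤ ∑' k : ℤ, ENNReal.ofReal (a * b ^ (k + 1)) * φ (a * b ^ k) := by
  have hsub : Ioi 0 ⊆ ⋃ k : ℤ, Ioc (a * b ^ k) (a * b ^ (k + 1)) := fun t ht => by
    obtain ⟨k, hk1, hk2⟩ := exists_mem_Ioc_zpow (div_pos ht ha) hb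
    exact mem_iUnion.2 ⟨k, (lt_div_iff₀' ha).1 hk1, (div_le_iff₀' ha).1 hk2⟩
  refine (lintegral_mono_set hsub).trans ((lintegral_iUnion_le _ _).trans ?_)
  refine ENNReal.tsum_le_tsum fun k => ?_
  refine (setLIntegral_mono' measurableSet_Ioc fun t ht => hφ ht.1.le).trans ?_
  rw [setLIntegral_const, Real.volume_Ioc, mul_comm]
  gcongr
  have : 0 < a * b ^ k := by positivity
  linarith

theorem Antitone.tsum_zpow_le_lintegral_Ioi {φ : ℝ → ℝ≥0∞} (hφ : Antitone φ) {b : ℝ}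
    (hb : 1 < b) :
    ∑' k : ℤ, ENNReal.ofReal (b ^ k) * φ (b ^ k)
      ≤ ENNReal.ofReal (b / (b - 1)) * ∫⁻ t in Ioi 0, φ t := by
  have hb0 : 0 < b := by positivity
  have hsub : (⋃ k : ℤ, Ioc (b ^ k) (b ^ Order.succ k)) ⊆ Ioi 0 :=
    iUnion_subset fun k t ht => (zpow_pos hb0 k).trans ht.1
  calc ∑' k : ℤ, ENNReal.ofReal (b ^ k) * φ (b ^ k)
      = ∑' k : ℤ, ENNReal.ofReal (b ^ (k + 1)) * φ (b ^ (k + 1)) :=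
        ((Equiv.addRight (1 : ℤ)).tsum_eq
          fun k : ℤ => ENNReal.ofReal (b ^ k) * φ (b ^ k)).symm
    _ ≤ ∑' k : ℤ, ENNReal.ofReal (b / (b - 1)) * ∫⁻ t in Ioc (b ^ k) (b ^ (k + 1)), φ t := by
        refine ENNReal.tsum_le_tsum fun k => ?_
        calc _ = ENNReal.ofReal (b / (b - 1)) *
              ∫⁻ _ in Ioc (b ^ k) (b ^ (k + 1)), φ (b ^ (k + 1)) := by
              rw [setLIntegral_const, Real.volume_Ioc, mul_left_comm,
                ← ENNReal.ofReal_mul (div_nonneg hb0.le (by linarith)), mul_comm]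
              congr 2
              have : b - 1 ≠ 0 := by linarith
              rw [zpow_add_one₀ hb0.ne']
              field_simp
          _ ≤ _ := by
              refine mul_le_mul_right ?_ _
              exact setLIntegral_mono' measurableSet_Ioc fun t ht => hφ ht.2
    _ = ENNReal.ofReal (b / (b - 1)) *
          ∫⁻ t in ⋃ k : ℤ, Ioc (b ^ k) (b ^ Order.succ k), φ t := by
        rw [ENNReal.tsum_mul_left, lintegral_iUnion (fun k : ℤ => measurableSet_Ioc)
          (zpow_right_mono₀ hb.le).pairwise_disjoint_on_Ioc_succ]
        rfl
    _ ≤ _ := by gcongr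

end DyadicSums

theorem antitone_hContent_superlevel {n : ℕ} {δ : ℝ} (Ω : Set (EuclideanSpace ℝ (Fin n)))
    (f : EuclideanSpace ℝ (Fin n) → ℝ) : Antitone fun t => hContent n δ {x ∈ Ω | t < f x} :=
  fun _ _ hst => hContent_mono fun _ hx => ⟨hx.1, hst.trans_lt hx.2⟩

theorem tsum_rpow_mul_zpow_neg_ne_top {p q : ℝ} (hqp : q < p) :
    ∑' i : ℕ, ((2 : ℝ≥0∞) ^ (i + 1)) ^ q * ENNReal.ofReal (((2 : ℝ) ^ p) ^ (-(i : ℤ))) ≠ ⊤ := by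
  have h : ∀ i : ℕ, ((2 : ℝ≥0∞) ^ (i + 1)) ^ q * ENNReal.ofReal (((2 : ℝ) ^ p) ^ (-(i : ℤ))) =
      2 ^ q * ((2 : ℝ≥0∞) ^ (q - p)) ^ i := by
    intro i
    have hW : ((2 : ℝ≥0∞) ^ (i + 1)) ^ q = (2 ^ q) ^ (i + 1) := by
      rw [← ENNReal.rpow_natCast, ← ENNReal.rpow_mul, mul_comm, ENNReal.rpow_mul,
        ENNReal.rpow_natCast]
    rw [hW, zpow_neg, zpow_natCast, ENNReal.ofReal_inv_of_pos (by positivity),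
      ENNReal.ofReal_pow (by positivity), ← ENNReal.ofReal_rpow_of_pos two_pos,
      ENNReal.rpow_sub _ _ two_ne_zero ENNReal.ofNat_ne_top, ENNReal.ofReal_ofNat,
      div_eq_mul_inv, mul_pow, pow_succ, ENNReal.inv_pow]
    ring
  simp only [h]
  rw [ENNReal.tsum_mul_left, ENNReal.tsum_geometric]
  have h1 : (2 : ℝ≥0∞) ^ (q - p) < 1 :=
    ENNReal.rpow_lt_one_of_one_lt_of_neg (by norm_num) (by linarith)
  have h2 : (1 : ℝ≥0∞) - 2 ^ (q - p) ≠ 0 := (tsub_pos_of_lt h1).ne'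
  finiteness

/-- Poincaré inequality for `C¹₀`-functions w.r.t. Hausdorff content. For
`0 < δ ≤ n` and `p > δ/n` there is `c = c(n, δ, p)` such that for every bounded domain
`Ω ⊆ ℝⁿ` and every `u ∈ C¹₀(Ω)`,
`∫_Ω |u|^p dH^δ_∞ ≤ c diam(Ω)^p ∫_Ω |∇u|^p dH^δ_∞`. -/
theorem poincare_compact_support_content (n : ℕ) (hn : 2 ≤ n) (δ p : ℝ)
    (hδ0 : 0 < δ) (hδn : δ ≤ (n : ℝ)) (hp : δ / n < p) :
    ∃ c : ℝ≥0, 0 < c ∧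
      ∀ Ω : Set (EuclideanSpace ℝ (Fin n)), IsOpen Ω → IsConnected Ω → IsBounded Ω →
        ∀ u : EuclideanSpace ℝ (Fin n) → ℝ,
          ContDiff ℝ 1 u → HasCompactSupport u → tsupport u ⊆ Ω →
          choquet n δ Ω (fun x => |u x| ^ p)
            ≤ c * ENNReal.ofReal (Metric.diam Ω ^ p) *
                choquet n δ Ω fun x => ‖fderiv ℝ u x‖ ^ p := by
  have hn0 : (0 : ℝ) < n := by positivity
  have hp0 : 0 < p := (by positivity : 0 < δ / n).trans hp
  set q := δ / n with hq
  set b : ℝ := 2 ^ p with hb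
  have hb1 : 1 < b := Real.one_lt_rpow one_lt_two hp0
  have hb0 : 0 < b := by positivity
  set K : ℝ≥0∞ := 2 ^ δ + 36 ^ δ with hK
  set A : ℝ≥0∞ := ∑' i : ℕ, ((2 : ℝ≥0∞) ^ (i + 1)) ^ q * ENNReal.ofReal (b ^ (-(i : ℤ))) with hA
  have hAt : A ≠ ⊤ := tsum_rpow_mul_zpow_neg_ne_top hp
  set C : ℝ≥0∞ := ENNReal.ofReal (6 ^ p * b) * K * A * ENNReal.ofReal (b / (b - 1)) with hC
  have hCt : C ≠ ⊤ := by finiteness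
  refine ⟨C.toNNReal + 1, by positivity, fun Ω hΩo hΩc hΩb u hu _ hsupp => ?_⟩
  have : Nonempty (Fin n) := ⟨⟨0, by lia⟩⟩
  obtain ⟨v₀, hv₀⟩ := exists_norm_eq (EuclideanSpace ℝ (Fin n)) zero_le_two
  have hD : 0 < diam Ω := by
    obtain ⟨x, hx⟩ := hΩc.nonempty
    exact diam_pos (infinite_of_mem_nhds x (hΩo.mem_nhds hx)).nontrivial hΩb
  have hu0 : ∀ x ∉ Ω, u x = 0 := fun x hx => image_eq_zero_of_notMem_tsupport fun h => hx (hsupp h)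
  have hdu0 : ∀ x ∉ Ω, fderiv ℝ u x = 0 := fun x hx =>
    image_eq_zero_of_notMem_tsupport fun h => hx (hsupp (tsupport_fderiv_subset ℝ h))
  have hΩ : ∀ x ∈ Ω, ∀ v ∈ ball v₀ 1, x + ((diam Ω).toNNReal : ℝ) • v ∉ Ω := by
    intro x hx v hv hxv
    rw [Real.coe_toNNReal _ hD.le] at hxv
    have h1 := dist_le_diam_of_mem hΩb hxv hx
    rw [dist_eq_norm, add_sub_cancel_left, norm_smul, Real.norm_eq_abs, abs_of_pos hD] at h1
    rw [mem_ball, dist_eq_norm, norm_sub_rev] at hv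
    have h2 := norm_le_norm_add_norm_sub' v₀ v
    nlinarith
  set φ : ℝ → ℝ≥0∞ := fun t => hContent n δ {x ∈ Ω | t < ‖fderiv ℝ u x‖ ^ p} with hφ
  have hφa : Antitone φ := antitone_hContent_superlevel Ω _
  set a : ℝ := (6 * diam Ω) ^ p with ha
  have ha0 : 0 < a := by positivity
  have hzpow : ∀ k : ℤ, b ^ k = ((2 : ℝ) ^ k) ^ p := fun k => by
    rw [hb, ← Real.rpow_intCast, ← Real.rpow_mul two_pos.le, mul_comm,
      Real.rpow_mul two_pos.le, Real.rpow_intCast]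
  have hweak : ∀ k : ℤ, hContent n δ {x ∈ Ω | a * b ^ k < |u x| ^ p} ≤
      K * ∑' i : ℕ, ((2 : ℝ≥0∞) ^ (i + 1)) ^ q * φ (b ^ (k + i)) := by
    intro k
    have hT : 0 < (2 : ℝ≥0) ^ k := by positivity
    refine (hContent_mono ?_).trans
      ((hContent_superlevel_le_tsum hn hδ0 hδn hv₀ hΩ hu hu0 hT).trans ?_)
    · rintro x ⟨hx, hux⟩
      refine ⟨hx, ?_⟩
      rw [ha, hzpow, ← Real.mul_rpow (by positivity) (by positivity),
        Real.rpow_lt_rpow_iff (by positivity) (abs_nonneg _) hp0] at hux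
      have h6 : (6 * (diam Ω).toNNReal * ((2 : ℝ≥0) ^ k : ℝ≥0) : ℝ≥0∞) =
          ENNReal.ofReal (6 * diam Ω * 2 ^ k) := by
        rw [ENNReal.ofReal_mul (by positivity), ENNReal.ofReal_mul (by norm_num),
          ENNReal.ofReal_ofNat]
        congr 1
        rw [← ENNReal.ofReal_coe_nnreal]
        push_cast
        rfl
      rw [h6, Real.enorm_eq_ofReal_abs]
      exact (ENNReal.ofReal_lt_ofReal_iff_of_nonneg (by positivity)).2 hux
    · gcongr with i
      refine hContent_mono fun x hx => ?_
      have h2 : (((2 : ℝ≥0) ^ k : ℝ≥0) * 2 ^ i : ℝ≥0∞) = ENNReal.ofReal (2 ^ (k + (i : ℤ))) := by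
        rw [zpow_add₀ two_ne_zero, ENNReal.ofReal_mul (by positivity), zpow_natCast,
          ENNReal.ofReal_pow two_pos.le, ENNReal.ofReal_ofNat, ← ENNReal.ofReal_coe_nnreal]
        push_cast
        rfl
      rw [mem_ofPred_eq, h2, ← ofReal_norm,
        ENNReal.ofReal_lt_ofReal_iff_of_nonneg (by positivity)] at hx
      refine ⟨by_contra fun hxΩ => ?_, ?_⟩
      · rw [hdu0 x hxΩ, norm_zero] at hx
        exact hx.not_ge (by positivity)
      · rw [hzpow]
        exact Real.rpow_lt_rpow (by positivity) hx hp0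
  calc choquet n δ Ω (fun x => |u x| ^ p)
      ≤ ∑' k : ℤ, ENNReal.ofReal (a * b ^ (k + 1)) *
          hContent n δ {x ∈ Ω | a * b ^ k < |u x| ^ p} :=
        (antitone_hContent_superlevel Ω _).lintegral_Ioi_le_tsum_zpow ha0 hb1
    _ ≤ ∑' k : ℤ, ENNReal.ofReal (a * b ^ (k + 1)) *
          (K * ∑' i : ℕ, ((2 : ℝ≥0∞) ^ (i + 1)) ^ q * φ (b ^ (k + i))) := by
        gcongr with k
        exact hweak k
    _ = ∑' k : ℤ, ∑' i : ℕ, ENNReal.ofReal (a * b) * K * (((2 : ℝ≥0∞) ^ (i + 1)) ^ q *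
          ENNReal.ofReal (b ^ (-(i : ℤ)))) * (ENNReal.ofReal (b ^ (k + i)) * φ (b ^ (k + i))) := by
        refine tsum_congr fun k => ?_
        rw [← ENNReal.tsum_mul_left, ← ENNReal.tsum_mul_left]
        refine tsum_congr fun i => ?_
        have : ENNReal.ofReal (a * b ^ (k + 1)) = ENNReal.ofReal (a * b) *
            ENNReal.ofReal (b ^ (-(i : ℤ))) * ENNReal.ofReal (b ^ (k + i)) := by
          rw [← ENNReal.ofReal_mul (by positivity), ← ENNReal.ofReal_mul (by positivity),
            zpow_add₀ hb0.ne', zpow_add₀ hb0.ne', zpow_neg, zpow_one]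
          congr 1
          field_simp
        rw [this]
        ring
    _ = ENNReal.ofReal (a * b) * K * A * ∑' k : ℤ, ENNReal.ofReal (b ^ k) * φ (b ^ k) := by
        rw [ENNReal.tsum_comm]
        have : ∀ i : ℕ, ∑' k : ℤ, ENNReal.ofReal (b ^ (k + i)) * φ (b ^ (k + i)) =
            ∑' k : ℤ, ENNReal.ofReal (b ^ k) * φ (b ^ k) := fun i =>
          (Equiv.addRight (i : ℤ)).tsum_eq fun k : ℤ => ENNReal.ofReal (b ^ k) * φ (b ^ k)
        simp only [ENNReal.tsum_mul_left, this]
        rw [ENNReal.tsum_mul_right, ENNReal.tsum_mul_left]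
    _ ≤ ENNReal.ofReal (a * b) * K * A *
          (ENNReal.ofReal (b / (b - 1)) * ∫⁻ t in Ioi 0, φ t) := by
        gcongr
        exact hφa.tsum_zpow_le_lintegral_Ioi hb1
    _ = C * ENNReal.ofReal (diam Ω ^ p) * choquet n δ Ω fun x => ‖fderiv ℝ u x‖ ^ p := by
        have : ENNReal.ofReal (a * b) =
            ENNReal.ofReal (6 ^ p * b) * ENNReal.ofReal (diam Ω ^ p) := by
          rw [← ENNReal.ofReal_mul (by positivity), ha, Real.mul_rpow (by norm_num) hD.le]
          ring_nf
        rw [this, hC, choquet]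
        ring
    _ ≤ _ := by
        gcongr
        rw [ENNReal.coe_add, ENNReal.coe_toNNReal hCt]
        exact le_self_add
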